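/- Let X be a semisimplicial set satisfying the Kan condition. Then there exist functions s_j : X_n → X_{n+1}, defined for all n ≥ 0 and 0 ≤ j ≤ n, satisfying the simplicial identities: (i) d_i ∘ s_j = s_{j-1} ∘ d_i whenever i < j; (ii) d_i(s_j x) = x whenever i = j or i = j+1; (iii) d_i ∘ s_j = s_j ∘ d_{i-1} whenever i > j+1; (iv) s_j ∘ s_i = s_i ∘ s_{j-1} whenever i < j. -/

import Mathlib

/-- A semisimplicial set: a sequence of sets `X n` together with face maps
`d i : X (n+1) → X n` (for `0 ≤ i ≤ n+1`) satisfying `d i ∘ d j = d (j-1) ∘ d i` for `i < j`. -/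
structure SemisimplicialSet where
  X : ℕ → Type
  d : (n : ℕ) → ℕ → X (n + 1) → X n
  face_comm : ∀ (n i j : ℕ), i < j → j ≤ n + 2 → ∀ x : X (n + 2),
    d n i (d (n + 1) j x) = d n (j - 1) (d (n + 1) i x)

/-- The Kan condition: every consistent collection of `n+1` of the `n+2` faces of a
potential `(n+1)`-simplex (all except the `k`-th) can be filled. -/
def SemisimplicialSet.Kan (S : SemisimplicialSet) : Prop :=
  (∀ k : ℕ, k ≤ 1 → ∀ x : ℕ → S.X 0,
      ∃ y : S.X 1, ∀ i : ℕ, i ≤ 1 → i ≠ k → S.d 0 i y = x i) ∧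
  (∀ n k : ℕ, k ≤ n + 2 → ∀ x : ℕ → S.X (n + 1),
      (∀ i j : ℕ, i < j → j ≤ n + 2 → i ≠ k → j ≠ k →
        S.d n i (x j) = S.d n (j - 1) (x i)) →
      ∃ y : S.X (n + 2), ∀ i : ℕ, i ≤ n + 2 → i ≠ k → S.d (n + 1) i y = x i)

namespace SemisimplicialSet

variable (S : SemisimplicialSet)

/-- The simplicial identities for those operators `s n j` with `j < p`. -/
structure Degeneracies (p : ℕ) (s : (n : ℕ) → ℕ → S.X n → S.X (n + 1)) : Prop where
  lt : ∀ n i j : ℕ, j < p → i < j → j ≤ n + 1 → ∀ x : S.X (n + 1),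
    S.d (n + 1) i (s (n + 1) j x) = s n (j - 1) (S.d n i x)
  self : ∀ n j : ℕ, j < p → j ≤ n → ∀ x : S.X n, S.d n j (s n j x) = x
  succ : ∀ n j : ℕ, j < p → j ≤ n → ∀ x : S.X n, S.d n (j + 1) (s n j x) = x
  gt : ∀ n i j : ℕ, j < p → j + 1 < i → i ≤ n + 2 → ∀ x : S.X (n + 1),
    S.d (n + 1) i (s (n + 1) j x) = s n j (S.d n (i - 1) x)
  comm : ∀ n i j : ℕ, j < p → i < j → j ≤ n + 1 → ∀ x : S.X n,
    s (n + 1) j (s n i x) = s (n + 1) i (s n (j - 1) x)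

variable {S}

/-- The faces of `y` other than `d p y` and `d (p + 1) y` are those prescribed for the `p`-th
degeneracy of `x`, where `R` is the graph of the `p`-th degeneracy on simplices of lower
dimension. -/
def DegeneracyFaces (p : ℕ) (s : (n : ℕ) → ℕ → S.X n → S.X (n + 1))
    (R : (n : ℕ) → S.X n → S.X (n + 1) → Prop) : (n : ℕ) → S.X n → S.X (n + 1) → Prop
  | 0, _, _ => True
  | n + 1, x, y => (∀ i, i < p → S.d (n + 1) i y = s n (p - 1) (S.d n i x)) ∧
      ∀ i, p + 1 < i → i ≤ n + 2 → R n (S.d n (i - 1) x) (S.d (n + 1) i y)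

/-- `R` is the graph of a partially defined `p`-th degeneracy operator whose domain is closed under
the operator and under the faces `d i` with `p < i`. -/
structure PartialDegeneracy (p : ℕ) (s : (n : ℕ) → ℕ → S.X n → S.X (n + 1))
    (R : (n : ℕ) → S.X n → S.X (n + 1) → Prop) : Prop where
  unique : ∀ n x y y', R n x y → R n x y' → y = y'
  le : ∀ n x y, R n x y → p ≤ n
  self : ∀ n x y, R n x y → S.d n p y = x
  succ : ∀ n x y, R n x y → S.d n (p + 1) y = x
  faces : ∀ n x y, R n x y → DegeneracyFaces p s R n x y
  next : ∀ n x y, R n x y → ∃ z, R (n + 1) y z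

/-- The part of the graph of the `p`-th degeneracy that is forced by the identity
`s p ∘ s i = s i ∘ s (p - 1)` for `i < p`. -/
inductive ForcedDegeneracy (p : ℕ) (s : (n : ℕ) → ℕ → S.X n → S.X (n + 1)) :
    (n : ℕ) → S.X n → S.X (n + 1) → Prop
  | mk (n i : ℕ) (u : S.X n) (hi : i < p) (hn : p ≤ n + 1) :
      ForcedDegeneracy p s (n + 1) (s n i u) (s (n + 1) i (s n (p - 1) u))

section

variable {p : ℕ} {s : (n : ℕ) → ℕ → S.X n → S.X (n + 1)}

theorem Degeneracies.forced_unique (hs : S.Degeneracies p s) {n i j : ℕ} {u v : S.X n}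
    (hij : i ≤ j) (hj : j < p) (hn : p ≤ n + 1) (h : s n i u = s n j v) :
    s (n + 1) i (s n (p - 1) u) = s (n + 1) j (s n (p - 1) v) := by
  obtain rfl | hij := hij.eq_or_lt
  · have := congrArg (S.d n i) h
    rw [hs.self _ _ hj (by lia), hs.self _ _ hj (by lia)] at this
    rw [this]
  · obtain ⟨k, rfl⟩ : ∃ k, n = k + 1 := ⟨n - 1, by lia⟩
    have hu : u = s k (j - 1) (S.d k i v) := by
      rw [← hs.lt _ _ _ hj hij (by lia), ← h, hs.self _ _ (by lia) (by lia)]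
    have hv : v = s k i (S.d k i v) := by
      have : v = s k i (S.d k j u) := by
        have := hs.gt k (j + 1) i (by lia) (by lia) (by lia) u
        rwa [h, hs.succ _ _ hj (by lia), Nat.add_sub_cancel] at this
      have hw : S.d k j u = S.d k i v := by
        have := hs.succ k (j - 1) (by lia) (by lia) (S.d k i v)
        rwa [← hu, Nat.sub_add_cancel (by lia)] at this
      rwa [hw] at this
    generalize S.d k i v = w at hu hv
    subst hu hv
    rw [hs.comm k (j - 1) (p - 1) (by lia) (by lia) (by lia),
      hs.comm k i (p - 1) (by lia) (by lia) (by lia), hs.comm _ i j hj hij (by lia)]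

theorem Degeneracies.partialDegeneracy_forced (hs : S.Degeneracies p s) :
    PartialDegeneracy p s (ForcedDegeneracy p s) where
  unique := by
    rintro _ x y y' h h'
    generalize hx : x = x' at h'
    obtain ⟨n, i, u, hi, hn⟩ := h
    obtain ⟨_, j, v, hj, -⟩ := h'
    obtain h | h := le_total i j
    · exact hs.forced_unique h hj hn hx
    · exact (hs.forced_unique h hi hn hx.symm).symm
  le := by
    rintro _ _ _ ⟨n, i, u, hi, hn⟩
    exact hn
  self := by
    rintro _ _ _ ⟨n, i, u, hi, hn⟩
    obtain h | h := eq_or_ne (i + 1) p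
    · subst h
      rw [Nat.add_sub_cancel, hs.succ _ _ (by lia) (by lia)]
    · rw [hs.gt _ _ _ hi (by lia) (by lia), hs.self _ _ (by lia) (by lia)]
  succ := by
    rintro _ _ _ ⟨n, i, u, hi, hn⟩
    have := hs.succ n (p - 1) (by lia) (by lia) u
    rw [Nat.sub_add_cancel (by lia)] at this
    rw [hs.gt _ _ _ hi (by lia) (by lia), Nat.add_sub_cancel, this]
  faces := by
    rintro _ _ _ ⟨n, i, u, hi, hn⟩
    refine ⟨fun q hq => ?_, fun q hq hqn => ?_⟩
    · obtain h | rfl | rfl | h : q < i ∨ q = i ∨ q = i + 1 ∨ i + 1 < q := by lia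
      · obtain ⟨k, rfl⟩ : ∃ k, n = k + 1 := ⟨n - 1, by lia⟩
        rw [hs.lt _ _ _ hi h (by lia), hs.lt _ _ _ hi h (by lia),
          hs.lt _ _ _ (by lia) (by lia) (by lia),
          hs.comm _ (i - 1) (p - 1) (by lia) (by lia) (by lia)]
      · rw [hs.self _ _ hi (by lia), hs.self _ _ hi (by lia)]
      · rw [hs.succ _ _ hi (by lia), hs.succ _ _ hi (by lia)]
      · obtain ⟨k, rfl⟩ : ∃ k, n = k + 1 := ⟨n - 1, by lia⟩
        rw [hs.gt _ _ _ hi h (by lia), hs.gt _ _ _ hi h (by lia),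
          hs.lt _ _ _ (by lia) (by lia) (by lia),
          hs.comm _ i (p - 1) (by lia) (by lia) (by lia)]
    · obtain ⟨k, rfl⟩ : ∃ k, n = k + 1 := ⟨n - 1, by lia⟩
      rw [hs.gt _ _ _ hi (by lia) (by lia), hs.gt _ _ _ hi (by lia) (by lia),
        hs.gt _ _ _ (by lia) (by lia) (by lia)]
      exact .mk _ _ _ hi (by lia)
  next := by
    rintro _ _ _ ⟨n, i, u, hi, hn⟩
    exact ⟨_, .mk _ _ _ hi (by lia)⟩

/-- `G` behaves like a simplex with vertices `0, …, p - 1, w, p, …, p, p + 1, …` in which `p` occurs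
`a + 1` times and the vertex `w` becomes a copy of `p` as soon as a vertex other than `p` is
omitted. -/
def IsPrism (p : ℕ) (s : (n : ℕ) → ℕ → S.X n → S.X (n + 1))
    (R : (n : ℕ) → S.X n → S.X (n + 1) → Prop) : (n a : ℕ) → S.X (n + 1) → Prop
  | 0, _, _ => True
  | n + 1, a, G =>
      (∀ i l, i < p → p ≤ l → l ≤ p + a + 1 →
        S.d (n + 1) i G = s n (p - 1) (S.d n i (S.d (n + 1) l G))) ∧
      (∀ l l', p < l → l < l' → l' ≤ p + a + 1 → S.d (n + 1) l G = S.d (n + 1) l' G) ∧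
      ∀ l t, p ≤ l → l ≤ p + a + 1 → p + a + 1 < t → t ≤ n + 2 →
        R n (S.d n (t - 1) (S.d (n + 1) l G)) (S.d (n + 1) t G)

/-- `G'` is obtained from the prism `G` by repeating the vertex `p` once more. -/
structure PrismSucc (p : ℕ) (s : (n : ℕ) → ℕ → S.X n → S.X (n + 1))
    (R : (n : ℕ) → S.X n → S.X (n + 1) → Prop) (n a : ℕ) (G : S.X (n + 1)) (G' : S.X (n + 2)) :
    Prop where
  lt : ∀ i, i < p → S.d (n + 1) i G' = s n (p - 1) (S.d n i G)
  mid : ∀ i, p < i → i ≤ p + a + 2 → S.d (n + 1) i G' = G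
  gt : ∀ i, p + a + 2 < i → i ≤ n + 2 → R n (S.d n (i - 1) G) (S.d (n + 1) i G')

variable {R : (n : ℕ) → S.X n → S.X (n + 1) → Prop}

theorem PartialDegeneracy.isPrism_of_prismSucc (hR : PartialDegeneracy p s R)
    (hs : S.Degeneracies p s) {n a : ℕ} {G : S.X (n + 1)} {G' : S.X (n + 2)} (ha : p + a ≤ n)
    (h : PrismSucc p s R n a G G') : IsPrism p s R (n + 1) (a + 1) G' := by
  refine ⟨fun i l hi hl hla => ?_, fun l l' hl hll hl' => ?_, fun l t hl hla ht htn => ?_⟩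
  · rw [h.lt i hi]
    obtain rfl | hl := hl.eq_or_lt
    · rw [S.face_comm _ _ _ hi (by lia), h.lt i hi, hs.self _ _ (by lia) (by lia)]
    · rw [h.mid l hl (by lia)]
  · rw [h.mid l hl (by lia), h.mid l' (by lia) (by lia)]
  · have := h.gt t (by lia) htn
    obtain rfl | hl := hl.eq_or_lt
    · rwa [← S.face_comm _ _ _ (by lia) htn, hR.self _ _ _ this]
    · rwa [h.mid l hl (by lia)]

theorem PartialDegeneracy.exists_prismSucc (hR : PartialDegeneracy p s R) (hK : S.Kan)
    (hs : S.Degeneracies p s) {n a : ℕ} {G : S.X (n + 1)} (ha : p + a ≤ n)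
    (h : IsPrism p s R n a G) : ∃ G', PrismSucc p s R n a G G' := by
  have key : ∀ i, ∃ v : S.X (n + 1), (i < p → v = s n (p - 1) (S.d n i G)) ∧
      (p < i → i ≤ p + a + 2 → v = G) ∧
      (p + a + 2 < i → i ≤ n + 2 → R n (S.d n (i - 1) G) v) := by
    intro i
    by_cases h1 : i < p
    · exact ⟨_, fun _ => rfl, by lia, by lia⟩
    by_cases h2 : p + a + 2 < i ∧ i ≤ n + 2
    · obtain ⟨k, rfl⟩ : ∃ k, n = k + 1 := ⟨n - 1, by lia⟩
      obtain ⟨z, hz⟩ := hR.next _ _ _ (h.2.2 p (i - 1) (by lia) (by lia) (by lia) (by lia))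
      exact ⟨z, by lia, by lia, fun _ _ => hz⟩
    · exact ⟨G, by lia, fun _ _ => rfl, by lia⟩
  choose x hlt hmid hgt using key
  obtain ⟨G', hG'⟩ := hK.2 n p (by lia) x (by
    intro i j hij hj hip hjp
    obtain hi | hi : i < p ∨ p < i := by lia
    · obtain ⟨k, rfl⟩ : ∃ k, n = k + 1 := ⟨n - 1, by lia⟩
      rw [hlt i hi]
      obtain hj' | hj' | hj' : j < p ∨ p < j ∧ j ≤ p + a + 2 ∨ p + a + 2 < j := by lia
      · rw [hlt j hj', hs.lt _ _ _ (by lia) (by lia) (by lia),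
          hs.lt _ _ _ (by lia) (by lia) (by lia), S.face_comm _ _ _ hij (by lia)]
      · rw [hmid j hj'.1 hj'.2]
        obtain rfl | hj'' : j = p + 1 ∨ p + 1 < j := by lia
        · have := hs.succ _ (p - 1) (by lia) (by lia) (S.d (k + 1) i G)
          rw [Nat.sub_add_cancel (by lia)] at this
          rw [Nat.add_sub_cancel, this]
        · rw [hs.gt _ _ _ (by lia) (by lia) (by lia), ← S.face_comm _ _ _ (by lia) (by lia)]
          exact h.1 i (j - 1) hi (by lia) (by lia)
      · rw [(hR.faces _ _ _ (hgt j hj' hj)).1 i hi, hs.gt _ _ _ (by lia) (by lia) (by lia),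
          S.face_comm _ _ _ (by lia) (by lia)]
    · obtain hj' | hj' : j ≤ p + a + 2 ∨ p + a + 2 < j := by lia
      · rw [hmid i hi (by lia), hmid j (by lia) hj']
        obtain hij' | hij' := eq_or_ne i (j - 1)
        · rw [hij']
        · obtain ⟨k, rfl⟩ : ∃ k, n = k + 1 := ⟨n - 1, by lia⟩
          exact h.2.1 i (j - 1) hi (by lia) (by lia)
      · obtain ⟨k, rfl⟩ : ∃ k, n = k + 1 := ⟨n - 1, by lia⟩
        have hRj := hgt j hj' hj
        obtain hi' | hi' : i ≤ p + a + 2 ∨ p + a + 2 < i := by lia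
        · rw [hmid i hi hi']
          obtain rfl | hi'' : i = p + 1 ∨ p + 1 < i := by lia
          · exact hR.succ _ _ _ hRj
          · have := (hR.faces _ _ _ hRj).2 i hi'' (by lia)
            rw [S.face_comm _ _ _ (by lia) (by lia)] at this
            exact hR.unique _ _ _ _ this
              (h.2.2 (i - 1) (j - 1) (by lia) (by lia) (by lia) (by lia))
        · have h1 := (hR.faces _ _ _ hRj).2 i (by lia) (by lia)
          have h2 := (hR.faces _ _ _ (hgt i hi' (by lia))).2 (j - 1) (by lia) (by lia)
          rw [S.face_comm _ _ _ (by lia) (by lia)] at h1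
          exact hR.unique _ _ _ _ h1 h2)
  refine ⟨G', fun i hi => ?_, fun i hi hia => ?_, fun i hi hin => ?_⟩
  · rw [hG' i (by lia) (by lia), hlt i hi]
  · rw [hG' i (by lia) (by lia), hmid i hi hia]
  · rw [hG' i (by lia) (by lia)]
    exact hgt i hi hin

theorem PartialDegeneracy.exists_isPrism (hR : PartialDegeneracy p s R) (hK : S.Kan)
    (hs : S.Degeneracies p s) {n : ℕ} (hn : p ≤ n) (x : S.X n)
    (hx : ∀ m, m < n → p ≤ m → ∀ u : S.X m, ∃ v, R m u v) :
    ∃ G : S.X (n + 1), S.d n p G = x ∧ IsPrism p s R n 0 G := by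
  obtain _ | n := n
  · obtain rfl : p = 0 := by lia
    obtain ⟨G, hG⟩ := hK.1 1 le_rfl fun _ => x
    exact ⟨G, hG 0 (by lia) (by lia), trivial⟩
  have key : ∀ i, ∃ v : S.X (n + 1), (i < p → v = s n (p - 1) (S.d n i x)) ∧
      (i = p → v = x) ∧ (p + 1 < i → i ≤ n + 2 → R n (S.d n (i - 1) x) v) := by
    intro i
    by_cases h1 : i < p
    · exact ⟨_, fun _ => rfl, by lia, by lia⟩
    by_cases h2 : p + 1 < i ∧ i ≤ n + 2
    · obtain ⟨z, hz⟩ := hx n (by lia) (by lia) (S.d n (i - 1) x)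
      exact ⟨z, by lia, by lia, fun _ _ => hz⟩
    · exact ⟨x, by lia, fun _ => rfl, by lia⟩
  choose f hlt heq hgt using key
  obtain ⟨G, hG⟩ := hK.2 n (p + 1) (by lia) f (by
    intro i j hij hj hip hjp
    obtain hi | rfl | hi : i < p ∨ i = p ∨ p + 1 < i := by lia
    · rw [hlt i hi]
      obtain hj' | rfl | hj' : j < p ∨ j = p ∨ p + 1 < j := by lia
      · obtain ⟨k, rfl⟩ : ∃ k, n = k + 1 := ⟨n - 1, by lia⟩
        rw [hlt j hj', hs.lt _ _ _ (by lia) (by lia) (by lia),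
          hs.lt _ _ _ (by lia) (by lia) (by lia), S.face_comm _ _ _ hij (by lia)]
      · rw [heq j rfl, hs.self _ _ (by lia) (by lia)]
      · obtain ⟨k, rfl⟩ : ∃ k, n = k + 1 := ⟨n - 1, by lia⟩
        rw [(hR.faces _ _ _ (hgt j hj' hj)).1 i hi, hs.gt _ _ _ (by lia) (by lia) (by lia),
          S.face_comm _ _ _ (by lia) (by lia)]
    · rw [heq i rfl, hR.self _ _ _ (hgt j (by lia) hj)]
    · obtain ⟨k, rfl⟩ : ∃ k, n = k + 1 := ⟨n - 1, by lia⟩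
      have h1 := (hR.faces _ _ _ (hgt j (by lia) hj)).2 i (by lia) (by lia)
      have h2 := (hR.faces _ _ _ (hgt i hi (by lia))).2 (j - 1) (by lia) (by lia)
      rw [S.face_comm _ _ _ (by lia) (by lia)] at h1
      exact hR.unique _ _ _ _ h1 h2)
  have hp : S.d (n + 1) p G = x := by rw [hG p (by lia) (by lia), heq p rfl]
  refine ⟨G, hp, fun i l hi hl hla => ?_, by lia, fun l t hl hla ht htn => ?_⟩
  · have hi' : S.d (n + 1) i G = s n (p - 1) (S.d n i x) := by
      rw [hG i (by lia) (by lia), hlt i hi]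
    obtain rfl | rfl : l = p ∨ l = p + 1 := by lia
    · rw [hp, hi']
    · have := hs.succ _ (p - 1) (by lia) (by lia) (S.d n i x)
      rw [Nat.sub_add_cancel (by lia)] at this
      rw [S.face_comm _ _ _ (by lia) (by lia), hi', Nat.add_sub_cancel, this]
  · have ht' := hgt t (by lia) htn
    rw [← hG t htn (by lia)] at ht'
    obtain rfl | rfl : l = p ∨ l = p + 1 := by lia
    · rwa [hp]
    · rwa [← S.face_comm _ _ _ (by lia) htn, hR.succ _ _ _ ht']

theorem PartialDegeneracy.degeneracyFaces_of_prismSucc (hR : PartialDegeneracy p s R)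
    (hs : S.Degeneracies p s) {R' : (n : ℕ) → S.X n → S.X (n + 1) → Prop} (hRR' : R ≤ R')
    {n a : ℕ} {G : S.X (n + 2)} {G' : S.X (n + 3)} (ha : p + a ≤ n + 1)
    (hG : IsPrism p s R (n + 1) a G) (h : PrismSucc p s R (n + 1) a G G')
    (hprev : ∀ i, p + 1 < i → i ≤ p + a + 1 →
      R' n (S.d n (i - 1) (S.d (n + 1) p G)) (S.d (n + 1) p G)) :
    DegeneracyFaces p s R' (n + 1) (S.d (n + 1) p G) (S.d (n + 2) p G') := by
  refine ⟨fun i hi => ?_, fun i hi hin => ?_⟩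
  · rw [S.face_comm _ _ _ hi (by lia), h.lt i hi, hs.self _ _ (by lia) (by lia)]
    exact hG.1 i p hi le_rfl (by lia)
  · have := S.face_comm _ p (i + 1) (by lia) (by lia) G'
    rw [Nat.add_sub_cancel] at this
    rw [← this]
    obtain hia | hia : i ≤ p + a + 1 ∨ p + a + 1 < i := by lia
    · rw [h.mid _ (by lia) (by lia)]
      exact hprev i hi hia
    · rw [hR.self _ _ _ (h.gt (i + 1) (by lia) (by lia)), Nat.add_sub_cancel]
      exact hRR' _ _ _ (hG.2.2 p i le_rfl (by lia) hia hin)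

theorem DegeneracyFaces.mono {R' : (n : ℕ) → S.X n → S.X (n + 1) → Prop} (hRR' : R ≤ R')
    {n : ℕ} {x : S.X n} {y : S.X (n + 1)} (h : DegeneracyFaces p s R n x y) :
    DegeneracyFaces p s R' n x y := by
  obtain _ | n := n
  · trivial
  · exact ⟨h.1, fun i hi hin => hRR' _ _ _ (h.2 i hi hin)⟩

theorem PartialDegeneracy.exists_prism_sequence (hR : PartialDegeneracy p s R) (hK : S.Kan)
    (hs : S.Degeneracies p s) {n : ℕ} (hn : p ≤ n) (x : S.X n)
    (hx : ∀ m, m < n → p ≤ m → ∀ u : S.X m, ∃ v, R m u v) :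
    ∃ G : (a : ℕ) → S.X (n + a + 1), S.d n p (G 0) = x ∧
      (∀ a, IsPrism p s R (n + a) a (G a)) ∧
      ∀ a, PrismSucc p s R (n + a) a (G a) (G (a + 1)) := by
  obtain ⟨G₀, hG₀, hI₀⟩ := hR.exists_isPrism hK hs hn x hx
  have step (a : ℕ) (G : {G : S.X (n + a + 1) // IsPrism p s R (n + a) a G}) :
      ∃ G' : {G : S.X (n + (a + 1) + 1) // IsPrism p s R (n + (a + 1)) (a + 1) G},
        PrismSucc p s R (n + a) a G.1 G'.1 := by
    obtain ⟨G', hG'⟩ := hR.exists_prismSucc hK hs (by lia) G.2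
    exact ⟨⟨G', hR.isPrism_of_prismSucc hs (by lia) hG'⟩, hG'⟩
  choose f hf using step
  let F (a : ℕ) : {G : S.X (n + a + 1) // IsPrism p s R (n + a) a G} :=
    Nat.rec ⟨G₀, hI₀⟩ f a
  exact ⟨fun a => (F a).1, hG₀, fun a => (F a).2, fun a => hf a (F a)⟩

theorem PartialDegeneracy.exists_extension (hR : PartialDegeneracy p s R) (hK : S.Kan)
    (hs : S.Degeneracies p s) {n : ℕ} (hn : p ≤ n) (x : S.X n)
    (hx : ∀ m, m < n → p ≤ m → ∀ u : S.X m, ∃ v, R m u v) (hxR : ¬ ∃ y, R n x y) :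
    ∃ R', PartialDegeneracy p s R' ∧ R ≤ R' ∧ ∃ y, R' n x y := by
  obtain ⟨G, hG₀, hG, hGs⟩ := hR.exists_prism_sequence hK hs hn x hx
  let T (a : ℕ) : S.X (n + a) := S.d (n + a) p (G a)
  have hTself (a : ℕ) : S.d (n + a) p (T (a + 1)) = T a := by
    have := S.face_comm (n + a) p (p + 1) (by lia) (by lia) (G (a + 1))
    rw [Nat.add_sub_cancel, (hGs a).mid _ (by lia) (by lia)] at this
    exact this.symm
  have hTmid (a i : ℕ) (hi : p < i) (hia : i ≤ p + a + 1) : S.d (n + a) i (T (a + 1)) = T a := by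
    have := S.face_comm (n + a) p (i + 1) (by lia) (by lia) (G (a + 1))
    rw [Nat.add_sub_cancel, (hGs a).mid _ (by lia) (by lia)] at this
    exact this.symm
  have hTR (a : ℕ) : ¬ ∃ y, R (n + a) (T a) y := by
    induction a with
    | zero =>
      have : T 0 = x := hG₀
      rwa [this]
    | succ a ih =>
      rintro ⟨y, hy⟩
      have := (hR.faces (n + a + 1) _ _ hy).2 (p + 2) (by lia) (by lia)
      exact ih ⟨_, hTmid a (p + 1) (by lia) (by lia) ▸ this⟩
  let N (m : ℕ) (u : S.X m) (v : S.X (m + 1)) : Prop :=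
    ∃ a, ∃ h : n + a = m, h ▸ T a = u ∧ h ▸ T (a + 1) = v
  let R' (m : ℕ) (u : S.X m) (v : S.X (m + 1)) : Prop := R m u v ∨ N m u v
  have hRR' : R ≤ R' := fun m u v h => Or.inl h
  have hNR' (a : ℕ) : R' (n + a) (T a) (T (a + 1)) := Or.inr ⟨a, rfl, rfl, rfl⟩
  refine ⟨R', ⟨?_, ?_, ?_, ?_, ?_, ?_⟩, hRR', T 1, ?_⟩
  · rintro m u v v' (h | ⟨a, rfl, rfl, rfl⟩) (h' | ⟨b, hb, hbu, rfl⟩)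
    · exact hR.unique _ _ _ _ h h'
    · subst hb hbu
      exact absurd ⟨_, h⟩ (hTR b)
    · exact absurd ⟨_, h'⟩ (hTR a)
    · obtain rfl : b = a := by lia
      rfl
  · rintro m u v (h | ⟨a, rfl, rfl, rfl⟩)
    · exact hR.le _ _ _ h
    · lia
  · rintro m u v (h | ⟨a, rfl, rfl, rfl⟩)
    · exact hR.self _ _ _ h
    · exact hTself a
  · rintro m u v (h | ⟨a, rfl, rfl, rfl⟩)
    · exact hR.succ _ _ _ h
    · exact hTmid a _ (by lia) (by lia)
  · rintro m u v (h | ⟨a, rfl, rfl, rfl⟩)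
    · exact (hR.faces _ _ _ h).mono hRR'
    · obtain _ | a := a
      · obtain _ | k := n
        · trivial
        · exact hR.degeneracyFaces_of_prismSucc hs hRR' (by lia) (hG 0) (hGs 0) (by lia)
      · refine hR.degeneracyFaces_of_prismSucc hs hRR' (by lia) (hG (a + 1)) (hGs (a + 1))
          fun i hi hia => ?_
        have := hTmid a (i - 1) (by lia) (by lia)
        exact this.symm ▸ hNR' a
  · rintro m u v (h | ⟨a, rfl, rfl, rfl⟩)
    · obtain ⟨z, hz⟩ := hR.next _ _ _ h
      exact ⟨z, Or.inl hz⟩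
    · exact ⟨_, hNR' (a + 1)⟩
  · have : T 0 = x := hG₀
    exact this ▸ hNR' 0

theorem Degeneracies.exists_total (hs : S.Degeneracies p s) (hK : S.Kan) :
    ∃ R, PartialDegeneracy p s R ∧ ForcedDegeneracy p s ≤ R ∧
      ∀ n, p ≤ n → ∀ x : S.X n, ∃ y, R n x y := by
  obtain ⟨R, hR₀, hR⟩ := zorn_le_nonempty₀ {R | PartialDegeneracy p s R} (by
    intro c hc hchain R₁ hR₁
    have hle : ∀ R ∈ c, R ≤ fun n x y => ∃ R ∈ c, R n x y := fun R hR n x y h => ⟨R, hR, h⟩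
    refine ⟨fun n x y => ∃ R ∈ c, R n x y, ⟨?_, ?_, ?_, ?_, ?_, ?_⟩, hle⟩
    · rintro n x y y' ⟨R, hR, h⟩ ⟨R', hR', h'⟩
      obtain hRR | hRR := hchain.total hR hR'
      · exact (hc hR').unique _ _ _ _ (hRR _ _ _ h) h'
      · exact (hc hR).unique _ _ _ _ h (hRR _ _ _ h')
    · rintro n x y ⟨R, hR, h⟩
      exact (hc hR).le _ _ _ h
    · rintro n x y ⟨R, hR, h⟩
      exact (hc hR).self _ _ _ h
    · rintro n x y ⟨R, hR, h⟩
      exact (hc hR).succ _ _ _ h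
    · rintro n x y ⟨R, hR, h⟩
      exact ((hc hR).faces _ _ _ h).mono (hle R hR)
    · rintro n x y ⟨R, hR, h⟩
      obtain ⟨z, hz⟩ := (hc hR).next _ _ _ h
      exact ⟨z, R, hR, hz⟩) _ hs.partialDegeneracy_forced
  refine ⟨R, hR.prop, hR₀, fun n => ?_⟩
  induction n using Nat.strong_induction_on with
  | _ n ih =>
    intro hn x
    by_contra hx
    obtain ⟨R', hR', hRR', y, hy⟩ := hR.prop.exists_extension hK hs hn x ih hx
    exact hx ⟨y, hR.le_of_ge hR' hRR' _ _ _ hy⟩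

theorem Degeneracies.exists_succ (hs : S.Degeneracies p s) (hK : S.Kan) :
    ∃ s', S.Degeneracies (p + 1) s' ∧ ∀ n j, j < p → s' n j = s n j := by
  obtain ⟨R, hR, hR₀, htot⟩ := hs.exists_total hK
  have (n : ℕ) (x : S.X n) : ∃ y, p ≤ n → R n x y := by
    by_cases hn : p ≤ n
    · obtain ⟨y, hy⟩ := htot n hn x
      exact ⟨y, fun _ => hy⟩
    · exact ⟨s n 0 x, by lia⟩
  choose t ht using this
  let s' (n j : ℕ) : S.X n → S.X (n + 1) := if j = p then t n else s n j
  have hlt (n j : ℕ) (hj : j < p) : s' n j = s n j := if_neg hj.ne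
  have heq (n : ℕ) : s' n p = t n := if_pos rfl
  refine ⟨s', ⟨?_, ?_, ?_, ?_, ?_⟩, hlt⟩
  · intro n i j hj hij hjn x
    rw [hlt n (j - 1) (by lia)]
    obtain hj | rfl : j < p ∨ j = p := by lia
    · rw [hlt _ _ hj, hs.lt _ _ _ hj hij hjn]
    · rw [heq]
      exact (hR.faces _ _ _ (ht (n + 1) x (by lia))).1 i hij
  · intro n j hj hjn x
    obtain hj | rfl : j < p ∨ j = p := by lia
    · rw [hlt _ _ hj, hs.self _ _ hj hjn]
    · rw [heq, hR.self _ _ _ (ht _ _ hjn)]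
  · intro n j hj hjn x
    obtain hj | rfl : j < p ∨ j = p := by lia
    · rw [hlt _ _ hj, hs.succ _ _ hj hjn]
    · rw [heq, hR.succ _ _ _ (ht _ _ hjn)]
  · intro n i j hj hij hin x
    obtain hj | rfl : j < p ∨ j = p := by lia
    · rw [hlt _ _ hj, hlt _ _ hj, hs.gt _ _ _ hj hij hin]
    · rw [heq, heq]
      exact hR.unique _ _ _ _ ((hR.faces _ _ _ (ht (n + 1) x (by lia))).2 i hij hin)
        (ht _ _ (by lia))
  · intro n i j hj hij hjn x
    rw [hlt _ i (by lia), hlt _ i (by lia), hlt _ (j - 1) (by lia)]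
    obtain hj | rfl : j < p ∨ j = p := by lia
    · rw [hlt _ _ hj, hs.comm _ _ _ hj hij hjn]
    · rw [heq]
      exact hR.unique _ _ _ _ (ht _ _ hjn) (hR₀ _ _ _ (.mk n i x hij hjn))

end

theorem Kan.exists_cone (hK : S.Kan) (n : ℕ) :
    ∃ (f : S.X n → S.X (n + 1)) (g : S.X (n + 1) → S.X (n + 2)), (∀ x, S.d n 0 (f x) = x) ∧
      (∀ x, S.d (n + 1) 0 (g x) = x) ∧
      ∀ i x, 1 < i → i ≤ n + 2 → S.d (n + 1) i (g x) = f (S.d n (i - 1) x) := by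
  have extend (m : ℕ) (f : S.X m → S.X (m + 1)) (hf : ∀ x, S.d m 0 (f x) = x)
      (hff : ∀ i j (x : S.X (m + 1)), 1 < i → i < j → j ≤ m + 2 →
        S.d m i (f (S.d m (j - 1) x)) = S.d m (j - 1) (f (S.d m (i - 1) x))) :
      ∃ g : S.X (m + 1) → S.X (m + 2), (∀ x, S.d (m + 1) 0 (g x) = x) ∧
        ∀ i x, 1 < i → i ≤ m + 2 → S.d (m + 1) i (g x) = f (S.d m (i - 1) x) := by
    have (x : S.X (m + 1)) : ∃ y : S.X (m + 2), S.d (m + 1) 0 y = x ∧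
        ∀ i, 1 < i → i ≤ m + 2 → S.d (m + 1) i y = f (S.d m (i - 1) x) := by
      obtain ⟨y, hy⟩ := hK.2 m 1 (by lia) (fun i => if i = 0 then x else f (S.d m (i - 1) x)) (by
        intro i j hij hj hi1 hj1
        rw [if_neg (by lia : j ≠ 0)]
        obtain rfl | hi : i = 0 ∨ 1 < i := by lia
        · rw [if_pos rfl, hf]
        · rw [if_neg (by lia : i ≠ 0)]
          exact hff i j x hi hij hj)
      exact ⟨y, hy 0 (by lia) (by lia), fun i hi him => by
        rw [hy i him (by lia), if_neg (by lia)]⟩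
    choose g hg hg' using this
    exact ⟨g, hg, fun i x => hg' x i⟩
  induction n with
  | zero =>
    have (x : S.X 0) : ∃ y : S.X 1, S.d 0 0 y = x := by
      obtain ⟨y, hy⟩ := hK.1 1 le_rfl fun _ => x
      exact ⟨y, hy 0 (by lia) (by lia)⟩
    choose f hf using this
    obtain ⟨g, hg⟩ := extend 0 f hf (by lia)
    exact ⟨f, g, hf, hg⟩
  | succ n ih =>
    obtain ⟨f, g, hf, hg, hfg⟩ := ih
    obtain ⟨h, hh⟩ := extend (n + 1) g hg (by
      intro i j x hi hij hj
      rw [hfg i _ hi (by lia), hfg (j - 1) _ (by lia) (by lia),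
        S.face_comm _ _ _ (by lia) (by lia)])
    exact ⟨g, h, hg, hh⟩

end SemisimplicialSet

/-- **Rourke–Sanderson.** A semisimplicial set satisfying the Kan condition admits
degeneracy operators `s j : X n → X (n+1)` (for `0 ≤ j ≤ n`) satisfying the
simplicial identities. -/
theorem kan_semisimplicial_has_degeneracies (S : SemisimplicialSet) (hK : S.Kan) :
    ∃ s : (n : ℕ) → ℕ → S.X n → S.X (n + 1),
      (∀ (n i j : ℕ), i < j → j ≤ n + 1 → ∀ x : S.X (n + 1),
          S.d (n + 1) i (s (n + 1) j x) = s n (j - 1) (S.d n i x)) ∧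
      (∀ (n j : ℕ), j ≤ n → ∀ x : S.X n,
          S.d n j (s n j x) = x ∧ S.d n (j + 1) (s n j x) = x) ∧
      (∀ (n i j : ℕ), j + 1 < i → i ≤ n + 2 → ∀ x : S.X (n + 1),
          S.d (n + 1) i (s (n + 1) j x) = s n j (S.d n (i - 1) x)) ∧
      (∀ (n i j : ℕ), i < j → j ≤ n + 1 → ∀ x : S.X n,
          s (n + 1) j (s n i x) = s (n + 1) i (s n (j - 1) x)) := by
  choose c _ using hK.exists_cone
  have step (p : ℕ) (s : {s // S.Degeneracies p s}) :
      ∃ s' : {s // S.Degeneracies (p + 1) s}, ∀ n j, j < p → s'.1 n j = s.1 n j := by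
    obtain ⟨s', hs', h⟩ := s.2.exists_succ hK
    exact ⟨⟨s', hs'⟩, h⟩
  choose f hf using step
  let F (p : ℕ) : {s // S.Degeneracies p s} :=
    Nat.rec ⟨fun n _ => c n, by lia, by lia, by lia, by lia, by lia⟩ f p
  have hF (p n j : ℕ) (hj : j < p) : (F (j + 1)).1 n j = (F p).1 n j := by
    induction p, hj using Nat.le_induction with
    | base => rfl
    | succ p hp ih => rw [ih, ← hf p (F p) n j hp]
  refine ⟨fun n j => (F (j + 1)).1 n j, ?_, ?_, ?_, ?_⟩
  · intro n i j hij hj x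
    dsimp only
    rw [hF (j + 1) n (j - 1) (by lia)]
    exact (F (j + 1)).2.lt n i j (by lia) hij hj x
  · intro n j hj x
    exact ⟨(F (j + 1)).2.self n j (by lia) hj x, (F (j + 1)).2.succ n j (by lia) hj x⟩
  · intro n i j hij hi x
    exact (F (j + 1)).2.gt n i j (by lia) hij hi x
  · intro n i j hij hj x
    dsimp only
    rw [hF (j + 1) n i (by lia), hF (j + 1) (n + 1) i (by lia), hF (j + 1) n (j - 1) (by lia)]
    exact (F (j + 1)).2.comm n i j (by lia) hij hj x
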